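/- Assume σ₀ ≥ 2, let K ⊆ V ⊗ k be a strictly characteristic subspace, and let v ∈ V be a nonzero isotropic vector. Then v ⊗ 1 ∉ K; the quotient V⁻ = v^⊥/⟨v⟩ (with v^⊥ taken in V) is an 𝔽_p-vector space of dimension 2σ₀ − 2 whose induced symmetric bilinear form is non-degenerate and non-neutral; and the image of K ∩ (v^⊥ ⊗ k) under the quotient map to V⁻ ⊗ k is a strictly characteristic subspace of V⁻ ⊗ k of dimension σ₀ − 1. -/

import Mathlib

open TensorProduct

noncomputable section

variable (p : ℕ) [Fact p.Prime] (k : Type) [Field k] [CharP k p] [Algebra (ZMod p) k]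

/-- The `p`-power (Frobenius) map on `k` as a `ZMod p`-linear map. -/
def frobLin : k →ₗ[ZMod p] k where
  toFun a := a ^ p
  map_add' a b := add_pow_char a b p
  map_smul' c a := by
    simp only [RingHom.id_apply]
    rw [Algebra.smul_def, Algebra.smul_def, mul_pow, ← map_pow, ZMod.pow_card]

variable (V : Type) [AddCommGroup V] [Module (ZMod p) V]

/-- The Frobenius-semilinear endomorphism `φ = id_V ⊗ (λ ↦ λ^p)` of `k ⊗[𝔽_p] V`. -/
def frobT : (k ⊗[ZMod p] V) →ₛₗ[frobenius k p] (k ⊗[ZMod p] V) where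
  toFun := LinearMap.rTensor V (frobLin p k)
  map_add' := map_add _
  map_smul' c x := by
    induction x using TensorProduct.induction_on with
    | zero => simp
    | tmul a v =>
        simp [smul_tmul', frobLin, frobenius_def, mul_pow]
    | add x y hx hy => simp_all [smul_add]

variable [IsAlgClosed k]

instance : RingHomSurjective (frobenius k p) := ⟨surjective_frobenius k p⟩

/-- The base change to `k` of the bilinear form `B`. -/
abbrev bcForm (B : LinearMap.BilinForm (ZMod p) V) :
    LinearMap.BilinForm k (k ⊗[ZMod p] V) :=
  LinearMap.BilinForm.baseChange k B

variable (σ₀ : ℕ) (B : LinearMap.BilinForm (ZMod p) V)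

/-- `K ⊆ V ⊗ k` is a characteristic subspace: totally isotropic of dimension `σ₀`,
and `K + φ(K)` has dimension `σ₀ + 1`. -/
def IsCharacteristicSub (K : Submodule k (k ⊗[ZMod p] V)) : Prop :=
  (∀ x ∈ K, ∀ y ∈ K, bcForm p k V B x y = 0) ∧
  Module.finrank k K = σ₀ ∧
  Module.finrank k ↥(K ⊔ Submodule.map (frobT p k V) K) = σ₀ + 1

/-- `K` is strictly characteristic if moreover `∑ᵢ φ^i(K) = V ⊗ k`. -/
def IsStrictlyCharacteristicSub (K : Submodule k (k ⊗[ZMod p] V)) : Prop :=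
  IsCharacteristicSub p k V σ₀ B K ∧
  (⨆ i : ℕ, (Submodule.map (frobT p k V))^[i] K) = ⊤

/-- `l_K = K ∩ φ(K) ∩ ⋯ ∩ φ^{σ₀ − 1}(K)`. -/
def lK (K : Submodule k (k ⊗[ZMod p] V)) : Submodule k (k ⊗[ZMod p] V) :=
  ⨅ i : Fin σ₀, (Submodule.map (frobT p k V))^[(i : ℕ)] K

/-- The group `O_K(V)` of isometries of `(V, B)` such that `g ⊗ k` maps `K` to itself. -/
def OK (K : Submodule k (k ⊗[ZMod p] V)) : Subgroup (V ≃ₗ[ZMod p] V) where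
  carrier := {g : V ≃ₗ[ZMod p] V | (∀ x y : V, B (g x) (g y) = B x y) ∧
    Submodule.map (LinearMap.baseChange k (g : V →ₗ[ZMod p] V)) K = K}
  one_mem' := by
    refine ⟨fun x y => rfl, ?_⟩
    rw [LinearEquiv.coe_toLinearMap_one, LinearMap.baseChange_id, Submodule.map_id]
  mul_mem' := by
    rintro g h ⟨hg1, hg2⟩ ⟨hh1, hh2⟩
    refine ⟨fun x y => (hg1 (h x) (h y)).trans (hh1 x y), ?_⟩
    have hco : ((g * h : V ≃ₗ[ZMod p] V) : V →ₗ[ZMod p] V)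
        = (g : V →ₗ[ZMod p] V).comp (h : V →ₗ[ZMod p] V) := rfl
    rw [hco, LinearMap.baseChange_comp, Submodule.map_comp, hh2, hg2]
  inv_mem' := by
    rintro g ⟨hg1, hg2⟩
    constructor
    · intro x y
      have h1 : g (g⁻¹ x) = x := g.apply_symm_apply x
      have h2 : g (g⁻¹ y) = y := g.apply_symm_apply y
      have := hg1 (g⁻¹ x) (g⁻¹ y)
      rw [h1, h2] at this
      exact this.symm
    · conv_lhs => rw [← hg2]
      rw [← Submodule.map_comp, ← LinearMap.baseChange_comp]
      have hco : ((g⁻¹ : V ≃ₗ[ZMod p] V) : V →ₗ[ZMod p] V).comp (g : V →ₗ[ZMod p] V)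
          = LinearMap.id := by
        ext x
        exact g.symm_apply_apply x
      rw [hco, LinearMap.baseChange_id, Submodule.map_id]

end


section Statement12

variable (p : ℕ) [Fact p.Prime] (k : Type) [Field k] [CharP k p] [Algebra (ZMod p) k]
  [IsAlgClosed k] (V : Type) [AddCommGroup V] [Module (ZMod p) V]
  (B : LinearMap.BilinForm (ZMod p) V) (v : V)

/-- The orthogonal complement `v^⊥` of `v` in `V` with respect to `B`. -/
def vPerp : Submodule (ZMod p) V :=
  B.orthogonal (Submodule.span (ZMod p) {v})

/-- The line spanned by `v`, viewed as a submodule of `v^⊥`. -/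
def vLine : Submodule (ZMod p) (vPerp p V B v) :=
  (Submodule.span (ZMod p) {v}).comap (vPerp p V B v).subtype

/-- The quotient `V⁻ = v^⊥ / ⟨v⟩`. -/
abbrev VQuot := (vPerp p V B v) ⧸ (vLine p V B v)

end Statement12

/-! ### Abstract semilinear algebra -/

section Abstract

open Module

variable {k : Type} [Field k] {τ : k →+* k} [RingHomSurjective τ]
variable {W : Type} [AddCommGroup W] [Module k W]

lemma aux_finrank_map (φ : W →ₛₗ[τ] W) (hφ : Function.Injective φ) (S : Submodule k W) :
    finrank k (S.map φ) = finrank k S := by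
  have hj : Function.Bijective
      (fun x : S => (⟨φ x, Submodule.mem_map_of_mem x.2⟩ : S.map φ)) := by
    constructor
    · intro x y h
      exact Subtype.ext (hφ (Subtype.ext_iff.1 h))
    · rintro ⟨_, x, hx, rfl⟩
      exact ⟨⟨x, hx⟩, rfl⟩
  let g : S →+ S.map φ :=
    { toFun := fun x => ⟨φ x, Submodule.mem_map_of_mem x.2⟩
      map_zero' := by ext; simp
      map_add' := by intro x y; ext; simp }
  have := rank_eq_of_equiv_equiv (R := k) (R' := k) (M := S) (M₁ := S.map φ) τ
    (AddEquiv.ofBijective g hj) ⟨τ.injective, RingHomSurjective.is_surjective⟩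
    (by intro r m; ext; simp [g])
  unfold finrank
  rw [this]

lemma aux_orth_self [FiniteDimensional k W] (b : LinearMap.BilinForm k W)
    (hnd : b.Nondegenerate) (n : ℕ) (hW : finrank k W = 2 * n) (N : Submodule k W)
    (hN : ∀ x ∈ N, ∀ y ∈ N, b x y = 0) (hd : n ≤ finrank k N) (x : W)
    (hx : ∀ y ∈ N, b y x = 0) : x ∈ N := by
  have h1 : N ≤ b.orthogonal N := fun y hy z hz => hN z hz y hy
  have h2 : N = b.orthogonal N := by
    apply Submodule.eq_of_le_of_finrank_le h1
    rw [LinearMap.BilinForm.finrank_orthogonal hnd]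
    omega
  rw [h2]
  exact hx

lemma aux_iter_le (φ : W →ₛₗ[τ] W) (A T : Submodule k W) (h : A ≤ T) (hT : T.map φ ≤ T) (i : ℕ) :
    (Submodule.map φ)^[i] A ≤ T := by
  induction i with
  | zero => exact h
  | succ i ih =>
    rw [Function.iterate_succ_apply']
    exact (Submodule.map_mono ih).trans hT

lemma aux_map_iSup_le (φ : W →ₛₗ[τ] W) (A : Submodule k W) :
    (⨆ i : ℕ, (Submodule.map φ)^[i] A).map φ ≤ ⨆ i : ℕ, (Submodule.map φ)^[i] A := by
  rw [Submodule.map_iSup]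
  refine iSup_le fun i => ?_
  rw [← Function.iterate_succ_apply' (Submodule.map φ)]
  exact le_iSup (fun i : ℕ => (Submodule.map φ)^[i] A) (i + 1)

/-- A subspace stable under `φ` and contained in `K` is zero. -/
lemma aux_stable_zero (φ : W →ₛₗ[τ] W) (hφ : Function.Injective φ)
    [FiniteDimensional k W] (b : LinearMap.BilinForm k W) (hnd : b.Nondegenerate)
    (hb : ∀ x y, b (φ x) (φ y) = τ (b x y))
    (K : Submodule k W) (hK : ∀ x ∈ K, ∀ y ∈ K, b x y = 0)
    (htop : (⨆ i : ℕ, (Submodule.map φ)^[i] K) = ⊤)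
    (L : Submodule k W) (hL : L ≤ K) (hs : L.map φ ≤ L) (x : W) (hx : x ∈ L) : x = 0 := by
  have hs' : L.map φ = L :=
    Submodule.eq_of_le_of_finrank_eq hs (aux_finrank_map φ hφ L)
  have h1 : K ≤ b.orthogonal L := fun y hy z hz => hK z (hL hz) y hy
  have h2 : (b.orthogonal L).map φ ≤ b.orthogonal L := by
    rintro _ ⟨y, hy, rfl⟩ z hz
    rw [← hs'] at hz
    obtain ⟨z, hz, rfl⟩ := hz
    have : b z y = 0 := hy z hz
    change b (φ z) (φ y) = 0
    rw [hb, this, map_zero]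
  have h3 : (⊤ : Submodule k W) ≤ b.orthogonal L := by
    rw [← htop]
    exact iSup_le fun i => aux_iter_le φ _ _ h1 h2 i
  refine hnd.1 x fun y => ?_
  exact h3 (Submodule.mem_top (x := y)) x hx

/-- The main linear algebra statement, upstairs. -/
lemma aux_main (φ : W →ₛₗ[τ] W) (hφ : Function.Injective φ)
    [FiniteDimensional k W] (b : LinearMap.BilinForm k W) (hnd : b.Nondegenerate)
    (hsym : ∀ x y, b x y = b y x)
    (hb : ∀ x y, b (φ x) (φ y) = τ (b x y))
    (n : ℕ) (hn : 2 ≤ n) (hW : finrank k W = 2 * n)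
    (K : Submodule k W) (hK : ∀ x ∈ K, ∀ y ∈ K, b x y = 0)
    (hKd : finrank k K = n) (hKφ : finrank k ↥(K ⊔ K.map φ) = n + 1)
    (htop : (⨆ i : ℕ, (Submodule.map φ)^[i] K) = ⊤)
    (v : W) (hv : v ≠ 0) (hvv : b v v = 0) (hφv : φ v = v) :
    v ∉ K ∧ finrank k ↥(K ⊓ LinearMap.ker (b v)) = n - 1 ∧
    n - 2 ≤ finrank k ↥((K ⊓ K.map φ) ⊓ LinearMap.ker (b v)) ∧
    LinearMap.ker (b v) ≤
      (⨆ i : ℕ, (Submodule.map φ)^[i] (K ⊓ LinearMap.ker (b v))) ⊔ k ∙ v := by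
  have hvK : v ∉ K := by
    intro hvK
    refine hv (aux_stable_zero φ hφ b hnd hb K hK htop (k ∙ v) ?_ ?_ v
      (Submodule.mem_span_singleton_self v))
    · rwa [Submodule.span_singleton_le_iff_mem]
    · rintro _ ⟨y, hy, rfl⟩
      obtain ⟨c, rfl⟩ := Submodule.mem_span_singleton.1 hy
      rw [φ.map_smulₛₗ, hφv]
      exact Submodule.smul_mem _ _ (Submodule.mem_span_singleton_self v)
  have hbv : b v ≠ 0 := by
    intro h
    exact hv (hnd.1 v fun y => by rw [h]; rfl)
  have hH : finrank k (LinearMap.ker (b v)) + 1 = 2 * n := by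
    have := (b v).finrank_range_add_finrank_ker
    have h1 : LinearMap.range (b v) = ⊤ := LinearMap.range_eq_top.2
      (LinearMap.surjective hbv)
    rw [h1, finrank_top, finrank_self] at this
    omega
  have hcod : ∀ S : Submodule k W, finrank k S ≤ finrank k ↥(S ⊓ LinearMap.ker (b v)) + 1 := by
    intro S
    have h1 := Submodule.finrank_sup_add_finrank_inf_eq S (LinearMap.ker (b v))
    have h2 := Submodule.finrank_le (S ⊔ LinearMap.ker (b v))
    omega
  set A := K ⊓ LinearMap.ker (b v) with hA
  have hAd : finrank k A = n - 1 := by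
    have h1 := hcod K
    have h2 : A < K := by
      refine lt_of_le_of_ne inf_le_left fun h => hvK ?_
      apply aux_orth_self b hnd n hW K hK hKd.ge
      intro y hy
      rw [← h] at hy
      rw [hsym]
      exact hy.2
    have h3 := Submodule.finrank_lt_finrank_of_lt h2
    rw [← hA] at h1
    omega
  have hφK : finrank k (K.map φ) = n := by rw [aux_finrank_map φ hφ, hKd]
  have hMd : finrank k ↥(K ⊓ K.map φ) = n - 1 := by
    have h1 := Submodule.finrank_sup_add_finrank_inf_eq K (K.map φ)
    omega
  have hspan : ∀ S : Submodule k W, S ≤ K → finrank k ↥(S ⊔ k ∙ v) = finrank k S + 1 := by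
    intro S hS
    have h1 := Submodule.finrank_sup_add_finrank_inf_eq S (k ∙ v)
    have h2 : S ⊓ k ∙ v = ⊥ := by
      rw [eq_bot_iff]
      rintro x ⟨hx1, hx2⟩
      obtain ⟨c, rfl⟩ := Submodule.mem_span_singleton.1 hx2
      by_cases hc : c = 0
      · simp [hc]
      · exact absurd (hS ((Submodule.smul_mem_iff _ hc).1 hx1)) hvK
    rw [h2, finrank_bot, finrank_span_singleton hv] at h1
    omega
  have hiso : ∀ S : Submodule k W, (∀ x ∈ S, ∀ y ∈ S, b x y = 0) → (∀ x ∈ S, b v x = 0) →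
      ∀ x ∈ S ⊔ k ∙ v, ∀ y ∈ S ⊔ k ∙ v, b x y = 0 := by
    intro S hS hSv x hx y hy
    obtain ⟨x1, hx1, x2, hx2, rfl⟩ := Submodule.mem_sup.1 hx
    obtain ⟨y1, hy1, y2, hy2, rfl⟩ := Submodule.mem_sup.1 hy
    obtain ⟨c, rfl⟩ := Submodule.mem_span_singleton.1 hx2
    obtain ⟨d, rfl⟩ := Submodule.mem_span_singleton.1 hy2
    simp [hS x1 hx1 y1 hy1, hSv y1 hy1, hsym x1 v, hSv x1 hx1, hvv]
  refine ⟨hvK, hAd, ?_, ?_⟩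
  · have := hcod (K ⊓ K.map φ)
    omega
  set U := (⨆ i : ℕ, (Submodule.map φ)^[i] A) ⊔ k ∙ v with hU
  have hAU : A ≤ U := (le_iSup (fun i : ℕ => (Submodule.map φ)^[i] A) 0).trans le_sup_left
  have hvU : v ∈ U := (le_sup_right : k ∙ v ≤ U) (Submodule.mem_span_singleton_self v)
  have hUs : U.map φ = U := by
    apply Submodule.eq_of_le_of_finrank_eq _ (aux_finrank_map φ hφ U)
    rw [hU, Submodule.map_sup]
    refine sup_le_sup (aux_map_iSup_le φ A) ?_
    rintro _ ⟨y, hy, rfl⟩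
    obtain ⟨c, rfl⟩ := Submodule.mem_span_singleton.1 hy
    rw [φ.map_smulₛₗ, hφv]
    exact Submodule.smul_mem _ _ (Submodule.mem_span_singleton_self v)
  -- the orthogonal of `U`
  set L := b.orthogonal U with hL
  have hLs : ∀ x ∈ L, φ x ∈ L := by
    intro x hx z hz
    rw [← hUs] at hz
    obtain ⟨z, hz, rfl⟩ := hz
    have : b z x = 0 := hx z hz
    change b (φ z) (φ x) = 0
    rw [hb, this, map_zero]
  have hLv : ∀ x ∈ L, b v x = 0 := fun x hx => hx v hvU
  have hvL : v ∈ L := by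
    have h2 : U ≤ LinearMap.ker (b v) := by
      refine sup_le (iSup_le fun i => aux_iter_le φ _ _ inf_le_right ?_ i) ?_
      · rintro _ ⟨y, hy, rfl⟩
        have hy' : b v y = 0 := hy
        change b v (φ y) = 0
        rw [← hφv, hb, hy', map_zero]
      · rw [Submodule.span_singleton_le_iff_mem]
        exact hvv
    intro z hz
    change b z v = 0
    rw [hsym]
    exact h2 hz
  have hLdec : ∀ x ∈ L, ∃ y ∈ L ⊓ K, ∃ c : k, x = y + c • v := by
    intro x hx
    have h1 : x ∈ A ⊔ k ∙ v := by
      apply aux_orth_self b hnd n hW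
      · exact hiso A (fun x hx y hy => hK x hx.1 y hy.1) (fun x hx => hx.2)
      · rw [hspan A inf_le_left]; omega
      · intro y hy
        exact hx y ((sup_le hAU le_sup_right : A ⊔ k ∙ v ≤ U) hy)
    obtain ⟨y, hy, z, hz, rfl⟩ := Submodule.mem_sup.1 h1
    obtain ⟨c, rfl⟩ := Submodule.mem_span_singleton.1 hz
    refine ⟨y, ⟨?_, hy.1⟩, c, rfl⟩
    have := L.sub_mem hx (L.smul_mem c hvL)
    simpa using this
  have hLK : ∀ x ∈ L ⊓ K, x = 0 := by
    refine aux_stable_zero φ hφ b hnd hb K hK htop (L ⊓ K) inf_le_right ?_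
    rintro _ ⟨x, hx, rfl⟩
    obtain ⟨y, hy, c, hc⟩ := hLdec _ (hLs x hx.1)
    by_cases hc0 : c = 0
    · rw [hc, hc0, zero_smul, add_zero]
      exact hy
    exfalso
    have hvsum : ∀ m ∈ K ⊓ K.map φ, b v m = 0 := by
      rintro m ⟨hm1, m', hm2, rfl⟩
      have e1 : b (φ x) (φ m') = 0 := by rw [hb, hK x hx.2 m' hm2, map_zero]
      rw [hc, map_add, LinearMap.add_apply, hK y hy.2 _ hm1] at e1
      simpa [hc0] using e1
    have hLM : ∀ z ∈ L ⊓ K, z ∈ K.map φ := by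
      intro z hz
      have h1 : z ∈ (K ⊓ K.map φ) ⊔ k ∙ v := by
        apply aux_orth_self b hnd n hW
        · exact hiso _ (fun x hx y hy => hK x hx.1 y hy.1) hvsum
        · rw [hspan _ inf_le_left]; omega
        · intro w hw
          obtain ⟨m, hm, w2, hw2, rfl⟩ := Submodule.mem_sup.1 hw
          obtain ⟨d, rfl⟩ := Submodule.mem_span_singleton.1 hw2
          simp [hK m hm.1 z hz.2, hLv z hz.1]
      obtain ⟨m, hm, w2, hw2, rfl⟩ := Submodule.mem_sup.1 h1
      obtain ⟨d, rfl⟩ := Submodule.mem_span_singleton.1 hw2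
      by_cases hd : d = 0
      · simpa [hd] using hm.2
      · have := K.sub_mem hz.2 hm.1
        rw [add_sub_cancel_left, Submodule.smul_mem_iff _ hd] at this
        exact absurd this hvK
    have h1 : φ x ∈ K.map φ := Submodule.mem_map_of_mem hx.2
    have h2 := Submodule.sub_mem _ h1 (hLM y hy)
    rw [hc, add_sub_cancel_left, Submodule.smul_mem_iff _ hc0] at h2
    obtain ⟨u, hu, huv⟩ := h2
    rw [← hφv] at huv
    exact hvK (hφ huv ▸ hu)
  have hLle : L ≤ k ∙ v := by
    intro x hx
    obtain ⟨y, hy, c, rfl⟩ := hLdec x hx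
    rw [hLK y hy, zero_add]
    exact Submodule.smul_mem _ _ (Submodule.mem_span_singleton_self v)
  have hrefl : b.IsRefl := fun x y h => by rw [hsym, h]
  rw [← LinearMap.BilinForm.orthogonal_orthogonal hnd hrefl U, ← hL]
  intro x hx z hz
  obtain ⟨c, rfl⟩ := Submodule.mem_span_singleton.1 (hLle hz)
  have hx' : b v x = 0 := hx
  change b (c • v) x = 0
  simp [hx']

variable {H : Type} [AddCommGroup H] [Module k H] {Q : Type} [AddCommGroup Q] [Module k Q]

/-- The abstract form of the descent to the quotient. -/
lemma aux_quot (φ : W →ₛₗ[τ] W) (φH : H →ₛₗ[τ] H) (φQ : Q →ₛₗ[τ] Q)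
    (hφ : Function.Injective φ) (hφQ : Function.Injective φQ)
    [FiniteDimensional k W] [FiniteDimensional k H] [FiniteDimensional k Q]
    (b : LinearMap.BilinForm k W) (hnd : b.Nondegenerate)
    (hsym : ∀ x y, b x y = b y x)
    (hb : ∀ x y, b (φ x) (φ y) = τ (b x y))
    (n : ℕ) (hn : 2 ≤ n) (hW : finrank k W = 2 * n)
    (hHd : finrank k H = 2 * n - 1) (hQd : finrank k Q = 2 * n - 2)
    (K : Submodule k W) (hK : ∀ x ∈ K, ∀ y ∈ K, b x y = 0)
    (hKd : finrank k K = n) (hKφ : finrank k ↥(K ⊔ K.map φ) = n + 1)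
    (htop : (⨆ i : ℕ, (Submodule.map φ)^[i] K) = ⊤)
    (v : W) (hv : v ≠ 0) (hvv : b v v = 0) (hφv : φ v = v)
    (ι : H →ₗ[k] W) (hι : Function.Injective ι) (hιv : ∀ x, b v (ι x) = 0)
    (hιφ : ∀ x, ι (φH x) = φ (ι x))
    (q : H →ₗ[k] Q) (hq : Function.Surjective q) (hqφ : ∀ x, q (φH x) = φQ (q x))
    (h0 : H) (hh0 : ι h0 = v) (hqh0 : q h0 = 0)
    (bQ : LinearMap.BilinForm k Q) (hbQ : ∀ x y, bQ (q x) (q y) = b (ι x) (ι y)) :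
    v ∉ K ∧
    ((∀ x ∈ (K.comap ι).map q, ∀ y ∈ (K.comap ι).map q, bQ x y = 0) ∧
      finrank k ((K.comap ι).map q) = n - 1 ∧
      finrank k ↥((K.comap ι).map q ⊔ ((K.comap ι).map q).map φQ) = n - 1 + 1) ∧
    (⨆ i : ℕ, (Submodule.map φQ)^[i] ((K.comap ι).map q)) = ⊤ := by
  obtain ⟨hvK, hAd, hMd, hsup⟩ :=
    aux_main φ hφ b hnd hsym hb n hn hW K hK hKd hKφ htop v hv hvv hφv
  have hbv : b v ≠ 0 := by
    intro h
    exact hv (hnd.1 v fun y => by rw [h]; rfl)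
  have hrange : LinearMap.range ι = LinearMap.ker (b v) := by
    apply Submodule.eq_of_le_of_finrank_eq
    · rintro _ ⟨x, rfl⟩
      exact hιv x
    · rw [LinearMap.finrank_range_of_inj hι, hHd]
      have := (b v).finrank_range_add_finrank_ker
      have h1 : LinearMap.range (b v) = ⊤ := LinearMap.range_eq_top.2
        (LinearMap.surjective hbv)
      rw [h1, finrank_top, finrank_self] at this
      omega
  have hh0ne : h0 ≠ 0 := by
    rintro rfl
    exact hv (by rw [← hh0, map_zero])
  have hker : LinearMap.ker q = k ∙ h0 := by
    symm
    apply Submodule.eq_of_le_of_finrank_eq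
    · rw [Submodule.span_singleton_le_iff_mem]
      exact hqh0
    · rw [finrank_span_singleton hh0ne]
      have := q.finrank_range_add_finrank_ker
      rw [LinearMap.range_eq_top.2 hq, finrank_top] at this
      omega
  have hdim : ∀ S : Submodule k W, S ≤ LinearMap.ker (b v) → v ∉ S →
      finrank k ((S.comap ι).map q) = finrank k S := by
    intro S hS hvS
    have e1 : (S.comap ι).map ι = S := by
      rw [Submodule.map_comap_eq, hrange, inf_eq_right]
      exact hS
    have e2 : finrank k (S.comap ι) = finrank k S := by
      have := LinearMap.finrank_range_of_inj (f := ι.domRestrict (S.comap ι))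
        (fun x y h => Subtype.ext (hι h))
      rw [LinearMap.range_domRestrict, e1] at this
      exact this.symm
    have e3 : finrank k ((S.comap ι).map q) = finrank k (S.comap ι) := by
      have := LinearMap.finrank_range_of_inj (f := q.domRestrict (S.comap ι)) (by
        rw [← LinearMap.ker_eq_bot, eq_bot_iff]
        rintro ⟨x, hx⟩ hxq
        have hx' : x ∈ LinearMap.ker q := hxq
        rw [hker] at hx'
        obtain ⟨c, rfl⟩ := Submodule.mem_span_singleton.1 hx'
        by_cases hc : c = 0
        · simp [hc]
        · exfalso
          apply hvS
          rw [Submodule.mem_comap, map_smul, hh0, Submodule.smul_mem_iff _ hc] at hx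
          exact hx)
      rw [LinearMap.range_domRestrict] at this
      exact this
    rw [e3, e2]
  set KQ := (K.comap ι).map q with hKQ
  have hKQ' : KQ = ((K ⊓ LinearMap.ker (b v)).comap ι).map q := by
    rw [← hrange, Submodule.comap_inf]
    have : (LinearMap.range ι).comap ι = ⊤ := by
      rw [eq_top_iff]; intro x _; exact ⟨x, rfl⟩
    rw [this, inf_top_eq]
  have hKQd : finrank k KQ = n - 1 := by
    rw [hKQ', hdim _ inf_le_right (fun h => hvK h.1), hAd]
  have hUtop : (⨆ i : ℕ, (Submodule.map φQ)^[i] KQ) = ⊤ := by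
    set U := ⨆ i : ℕ, (Submodule.map φQ)^[i] KQ with hU
    have hle : LinearMap.ker (b v) ≤ (U.comap q).map ι := by
      refine hsup.trans (sup_le (iSup_le fun i => aux_iter_le φ _ _ ?_ ?_ i) ?_)
      · rintro x ⟨hx1, hx2⟩
        rw [← hrange] at hx2
        obtain ⟨y, rfl⟩ := hx2
        refine ⟨y, ?_, rfl⟩
        exact (le_iSup (fun i : ℕ => (Submodule.map φQ)^[i] KQ) 0) ⟨y, hx1, rfl⟩
      · rintro _ ⟨_, ⟨y, hy, rfl⟩, rfl⟩
        refine ⟨φH y, ?_, hιφ y⟩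
        change q (φH y) ∈ U
        rw [hqφ]
        exact aux_map_iSup_le φQ KQ (Submodule.mem_map_of_mem hy)
      · rw [Submodule.span_singleton_le_iff_mem]
        refine ⟨h0, ?_, hh0⟩
        change q h0 ∈ U
        rw [hqh0]
        exact U.zero_mem
    rw [eq_top_iff]
    intro z _
    obtain ⟨h, rfl⟩ := hq z
    obtain ⟨h', hh', e⟩ := hle (hιv h : ι h ∈ LinearMap.ker (b v))
    rw [← hι e]
    exact hh'
  refine ⟨hvK, ⟨?_, hKQd, ?_⟩, hUtop⟩
  · rintro _ ⟨x, hx, rfl⟩ _ ⟨y, hy, rfl⟩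
    rw [hbQ]
    exact hK _ hx _ hy
  · have hφKQ : finrank k (KQ.map φQ) = n - 1 := by rw [aux_finrank_map φQ hφQ, hKQd]
    have hs := Submodule.finrank_sup_add_finrank_inf_eq KQ (KQ.map φQ)
    have hlow : n - 2 ≤ finrank k ↥(KQ ⊓ KQ.map φQ) := by
      refine hMd.trans ?_
      rw [← hdim ((K ⊓ K.map φ) ⊓ LinearMap.ker (b v)) inf_le_right (fun h => hvK h.1.1)]
      apply Submodule.finrank_mono
      rintro _ ⟨x, ⟨⟨hx1, κ, hκ, hx2⟩, hx3⟩, rfl⟩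
      refine ⟨⟨x, hx1, rfl⟩, ?_⟩
      have hκv : b v κ = 0 := by
        have h3 : b v (ι x) = 0 := hx3
        rw [← hx2, ← hφv, hb] at h3
        exact (map_eq_zero τ).1 h3
      have hκ' : κ ∈ LinearMap.ker (b v) := hκv
      rw [← hrange] at hκ'
      obtain ⟨y, rfl⟩ := hκ'
      rw [← hιφ] at hx2
      rw [← hι hx2, hqφ]
      exact Submodule.mem_map_of_mem ⟨y, hκ, rfl⟩
    have hup : finrank k ↥(KQ ⊓ KQ.map φQ) ≠ n - 1 := by
      intro h
      have e1 : KQ ⊓ KQ.map φQ = KQ :=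
        Submodule.eq_of_le_of_finrank_eq inf_le_left (h.trans hKQd.symm)
      have e2 : KQ = KQ.map φQ :=
        Submodule.eq_of_le_of_finrank_eq (inf_eq_left.1 e1) (hKQd.trans hφKQ.symm)
      have e3 : (⊤ : Submodule k Q) ≤ KQ := by
        rw [← hUtop]
        exact iSup_le fun i => aux_iter_le φQ _ _ le_rfl e2.ge i
      have e4 := Submodule.finrank_mono e3
      rw [finrank_top, hQd, hKQd] at e4
      omega
    have hup' : finrank k ↥(KQ ⊓ KQ.map φQ) ≤ n - 1 := by
      rw [← hKQd]; exact Submodule.finrank_mono inf_le_left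
    omega

end Abstract

/-! ### Concrete facts -/

section Concrete

open Module

variable (p : ℕ) [Fact p.Prime] (k : Type) [Field k] [CharP k p] [Algebra (ZMod p) k]

lemma frobT_tmul (V : Type) [AddCommGroup V] [Module (ZMod p) V] (a : k) (v : V) :
    frobT p k V (a ⊗ₜ[ZMod p] v) = (a ^ p) ⊗ₜ[ZMod p] v := rfl

lemma frobT_injective (V : Type) [AddCommGroup V] [Module (ZMod p) V] :
    Function.Injective (frobT p k V) := by
  have h : Function.Injective (LinearMap.rTensor V (frobLin p k)) := by
    apply Module.Flat.rTensor_preserves_injective_linearMap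
    exact frobenius_inj k p
  exact h

lemma frobT_baseChange (V V' : Type) [AddCommGroup V] [Module (ZMod p) V]
    [AddCommGroup V'] [Module (ZMod p) V'] (f : V →ₗ[ZMod p] V') (x : k ⊗[ZMod p] V) :
    f.baseChange k (frobT p k V x) = frobT p k V' (f.baseChange k x) := by
  induction x using TensorProduct.induction_on with
  | zero => simp
  | tmul a v => simp [frobT_tmul]
  | add x y hx hy => simp only [map_add, hx, hy]

lemma bcForm_frobT [IsAlgClosed k] (V : Type) [AddCommGroup V] [Module (ZMod p) V]
    (B : LinearMap.BilinForm (ZMod p) V) (x y : k ⊗[ZMod p] V) :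
    bcForm p k V B (frobT p k V x) (frobT p k V y) = frobenius k p (bcForm p k V B x y) := by
  induction x using TensorProduct.induction_on with
  | zero => simp
  | add x x' hx hx' => simp only [map_add, LinearMap.add_apply, hx, hx']
  | tmul a v =>
    induction y using TensorProduct.induction_on with
    | zero => simp
    | add y y' hy hy' => simp only [map_add, hy, hy']
    | tmul a' v' =>
      simp only [frobT_tmul, LinearMap.BilinForm.baseChange_tmul, frobenius_def]
      rw [Algebra.smul_def, Algebra.smul_def, mul_pow, mul_pow, ← map_pow, ZMod.pow_card]

lemma bcForm_nondegenerate [IsAlgClosed k] (V : Type) [AddCommGroup V] [Module (ZMod p) V]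
    [FiniteDimensional (ZMod p) V]
    (B : LinearMap.BilinForm (ZMod p) V) (hB : B.Nondegenerate) :
    (bcForm p k V B).Nondegenerate := by
  classical
  let c := Module.finBasis (ZMod p) V
  rw [LinearMap.BilinForm.nondegenerate_iff_det_ne_zero (c.baseChange k)]
  rw [LinearMap.BilinForm.nondegenerate_iff_det_ne_zero c] at hB
  have : LinearMap.BilinForm.toMatrix (c.baseChange k) (bcForm p k V B) =
      (algebraMap (ZMod p) k).mapMatrix (LinearMap.BilinForm.toMatrix c B) := by
    ext i j
    simp [LinearMap.BilinForm.toMatrix_apply, Algebra.smul_def]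
  rw [this, ← RingHom.map_det]
  exact (map_ne_zero _).2 hB

lemma bcForm_comp [IsAlgClosed k] (V V' H : Type) [AddCommGroup V] [Module (ZMod p) V]
    [AddCommGroup V'] [Module (ZMod p) V'] [AddCommGroup H] [Module (ZMod p) H]
    (B : LinearMap.BilinForm (ZMod p) V) (B' : LinearMap.BilinForm (ZMod p) V')
    (f : H →ₗ[ZMod p] V) (f' : H →ₗ[ZMod p] V') (h : ∀ x y, B' (f' x) (f' y) = B (f x) (f y))
    (x y : k ⊗[ZMod p] H) :
    bcForm p k V' B' (f'.baseChange k x) (f'.baseChange k y) =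
      bcForm p k V B (f.baseChange k x) (f.baseChange k y) := by
  induction x using TensorProduct.induction_on with
  | zero => simp
  | add x x' hx hx' => simp only [map_add, LinearMap.add_apply, hx, hx']
  | tmul a v =>
    induction y using TensorProduct.induction_on with
    | zero => simp
    | add y y' hy hy' => simp only [map_add, hy, hy']
    | tmul a' v' => simp [h]

end Concrete

/-- if `σ₀ ≥ 2`, `K ⊆ V ⊗ k` is strictly characteristic and `v ∈ V` is a
nonzero isotropic vector, then `v ⊗ 1 ∉ K`; the quotient `V⁻ = v^⊥/⟨v⟩` has dimension
`2σ₀ - 2` and its induced symmetric bilinear form is non-degenerate and non-neutral; and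
the image of `K ∩ (v^⊥ ⊗ k)` in `V⁻ ⊗ k` is a strictly characteristic subspace of
dimension `σ₀ - 1`. -/
theorem statement12
    (p : ℕ) [Fact p.Prime] (hodd : Odd p)
    (k : Type) [Field k] [CharP k p] [Algebra (ZMod p) k] [IsAlgClosed k]
    (V : Type) [AddCommGroup V] [Module (ZMod p) V]
    (σ₀ : ℕ) (hσ : 1 ≤ σ₀)
    (hdim : Module.finrank (ZMod p) V = 2 * σ₀)
    (B : LinearMap.BilinForm (ZMod p) V)
    (hsymm : B.IsSymm) (hnd : B.Nondegenerate)
    (hnn : ∀ W : Submodule (ZMod p) V,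
      (∀ x ∈ W, ∀ y ∈ W, B x y = 0) → Module.finrank (ZMod p) W ≠ σ₀)
    (hσ₂ : 2 ≤ σ₀)
    (K : Submodule k (k ⊗[ZMod p] V))
    (hK : IsStrictlyCharacteristicSub p k V σ₀ B K)
    (v : V) (hv0 : v ≠ 0) (hviso : B v v = 0) :
    ((1 : k) ⊗ₜ[ZMod p] v ∉ K) ∧
    Module.finrank (ZMod p) (VQuot p V B v) = 2 * σ₀ - 2 ∧
    ∃ B' : LinearMap.BilinForm (ZMod p) (VQuot p V B v),
      (∀ x y : vPerp p V B v,
        B' (Submodule.Quotient.mk x) (Submodule.Quotient.mk y) = B (x : V) (y : V)) ∧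
      B'.IsSymm ∧ B'.Nondegenerate ∧
      (∀ W : Submodule (ZMod p) (VQuot p V B v),
        (∀ x ∈ W, ∀ y ∈ W, B' x y = 0) → Module.finrank (ZMod p) W ≠ σ₀ - 1) ∧
      IsStrictlyCharacteristicSub p k (VQuot p V B v) (σ₀ - 1) B'
        (Submodule.map (LinearMap.baseChange k (vLine p V B v).mkQ)
          (Submodule.comap (LinearMap.baseChange k (vPerp p V B v).subtype) K)) := by
  have hfin : FiniteDimensional (ZMod p) V := Module.finite_of_finrank_pos (by omega)
  have hmem : ∀ x : V, x ∈ vPerp p V B v ↔ B v x = 0 := by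
    intro x
    constructor
    · intro h
      exact h v (Submodule.mem_span_singleton_self v)
    · intro h y hy
      obtain ⟨c, rfl⟩ := Submodule.mem_span_singleton.1 hy
      change B (c • v) x = 0
      simp [h]
  have hvP : v ∈ vPerp p V B v := (hmem v).2 hviso
  have hline : ∀ x : vPerp p V B v, x ∈ vLine p V B v ↔ ∃ c : ZMod p, c • v = (x : V) := by
    intro x
    exact Submodule.mem_span_singleton
  have hPd : Module.finrank (ZMod p) (vPerp p V B v) = 2 * σ₀ - 1 := by
    unfold vPerp
    rw [LinearMap.BilinForm.finrank_orthogonal hnd, hdim, finrank_span_singleton hv0]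
  have hLd : Module.finrank (ZMod p) (vLine p V B v) = 1 := by
    have : vLine p V B v = Submodule.span (ZMod p) {⟨v, hvP⟩} := by
      ext x
      rw [hline, Submodule.mem_span_singleton]
      constructor
      · rintro ⟨c, hc⟩
        exact ⟨c, Subtype.ext hc⟩
      · rintro ⟨c, hc⟩
        exact ⟨c, congrArg Subtype.val hc⟩
    rw [this]
    exact finrank_span_singleton (fun h => hv0 (congrArg Subtype.val h))
  have hQd : Module.finrank (ZMod p) (VQuot p V B v) = 2 * σ₀ - 2 := by
    have := Submodule.finrank_quotient_add_finrank (vLine p V B v)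
    rw [hLd, hPd] at this
    change Module.finrank (ZMod p) (VQuot p V B v) + 1 = 2 * σ₀ - 1 at this
    omega
  have hker : vLine p V B v ≤ LinearMap.ker (B.restrict (vPerp p V B v)) := by
    intro x hx
    obtain ⟨c, hc⟩ := (hline x).1 hx
    rw [LinearMap.mem_ker]
    ext y
    change B (x : V) (y : V) = 0
    rw [← hc]
    simp [(hmem _).1 y.2]
  have hker' : vLine p V B v ≤ LinearMap.ker (B.restrict (vPerp p V B v)).flip := by
    intro x hx
    have h1 := hker hx
    rw [LinearMap.mem_ker] at h1 ⊢
    ext y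
    change B (y : V) (x : V) = 0
    rw [hsymm.eq]
    exact LinearMap.congr_fun h1 y
  let B' : LinearMap.BilinForm (ZMod p) (VQuot p V B v) :=
    LinearMap.liftQ₂ (vLine p V B v) (vLine p V B v) (B.restrict (vPerp p V B v)) hker hker'
  have hB' : ∀ x y : vPerp p V B v,
      B' (Submodule.Quotient.mk x) (Submodule.Quotient.mk y) = B (x : V) (y : V) :=
    fun x y => rfl
  have hvnb : (1 : k) ⊗ₜ[ZMod p] v ≠ 0 := by
    intro h
    apply hv0
    have h1 : Function.Injective (TensorProduct.mk (ZMod p) k V 1) :=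
      Module.FaithfullyFlat.tensorProduct_mk_injective V
    exact h1 (by simpa using h)
  obtain ⟨⟨hK1, hK2, hK3⟩, hK4⟩ := hK
  have hqsurj : Function.Surjective (LinearMap.baseChange k (vLine p V B v).mkQ) :=
    LinearMap.lTensor_surjective k (Submodule.mkQ_surjective _)
  have hιinj : Function.Injective (LinearMap.baseChange k (vPerp p V B v).subtype) :=
    Module.Flat.lTensor_preserves_injective_linearMap (M := k) (vPerp p V B v).subtype
      (Submodule.injective_subtype _)
  have key := aux_quot (frobT p k V) (frobT p k (vPerp p V B v)) (frobT p k (VQuot p V B v))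
    (frobT_injective p k V) (frobT_injective p k _)
    (bcForm p k V B) (bcForm_nondegenerate p k V B hnd)
    (fun x y => (LinearMap.BilinForm.IsSymm.baseChange k
      (LinearMap.BilinForm.isSymm_iff.1 hsymm)).eq x y)
    (bcForm_frobT p k V B) σ₀ hσ₂ (by rw [Module.finrank_baseChange, hdim])
    (by rw [Module.finrank_baseChange, hPd]) (by rw [Module.finrank_baseChange, hQd])
    K hK1 hK2 hK3 hK4 ((1 : k) ⊗ₜ[ZMod p] v) hvnb (by simp [hviso])
    (by rw [frobT_tmul, one_pow])
    (LinearMap.baseChange k (vPerp p V B v).subtype) hιinj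
    (by
      intro x
      induction x using TensorProduct.induction_on with
      | zero => simp
      | tmul a w => simp [(hmem _).1 w.2]
      | add x y hx hy => rw [map_add, map_add, hx, hy, add_zero])
    (frobT_baseChange p k _ _ _)
    (LinearMap.baseChange k (vLine p V B v).mkQ) hqsurj
    (frobT_baseChange p k _ _ _)
    ((1 : k) ⊗ₜ[ZMod p] (⟨v, hvP⟩ : vPerp p V B v)) (by simp)
    (by
      have : (vLine p V B v).mkQ ⟨v, hvP⟩ = 0 := by
        rw [← LinearMap.mem_ker, Submodule.ker_mkQ, hline]
        exact ⟨1, one_smul _ _⟩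
      rw [LinearMap.baseChange_tmul, this, TensorProduct.tmul_zero])
    (bcForm p k (VQuot p V B v) B')
    (bcForm_comp p k _ _ _ B B' _ _ (fun x y => rfl))
  refine ⟨key.1, hQd, B', hB', ?_, ?_, ?_, key.2⟩
  · constructor
    intro x y
    obtain ⟨x, rfl⟩ := Submodule.Quotient.mk_surjective _ x
    obtain ⟨y, rfl⟩ := Submodule.Quotient.mk_surjective _ y
    rw [hB', hB', hsymm.eq]
  · apply LinearMap.BilinForm.Nondegenerate.ofSeparatingLeft
    intro x hx
    obtain ⟨x, rfl⟩ := Submodule.Quotient.mk_surjective _ x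
    rw [Submodule.Quotient.mk_eq_zero]
    change (x : V) ∈ Submodule.span (ZMod p) {v}
    rw [← LinearMap.BilinForm.orthogonal_orthogonal hnd hsymm.isRefl
      (Submodule.span (ZMod p) {v})]
    intro y hy
    have := hx (Submodule.Quotient.mk ⟨y, hy⟩)
    rw [hB'] at this
    change B y x = 0
    rw [hsymm.eq]
    exact this
  · intro W hW hWd
    set C := W.comap (vLine p V B v).mkQ with hC
    have hLC : vLine p V B v ≤ C := by
      intro x hx
      have : (vLine p V B v).mkQ x = 0 := by
        rw [← LinearMap.mem_ker, Submodule.ker_mkQ]; exact hx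
      change (vLine p V B v).mkQ x ∈ W
      rw [this]
      exact W.zero_mem
    have hCd : Module.finrank (ZMod p) C = σ₀ := by
      have h1 := ((vLine p V B v).mkQ.domRestrict C).finrank_range_add_finrank_ker
      have h2 : LinearMap.ker ((vLine p V B v).mkQ.domRestrict C) =
          (vLine p V B v).comap C.subtype := by
        rw [LinearMap.ker_domRestrict, Submodule.ker_mkQ]
      rw [LinearMap.range_domRestrict, hC,
        Submodule.map_comap_eq_of_surjective (Submodule.mkQ_surjective _), ← hC, h2, hWd,
        (Submodule.comapSubtypeEquivOfLe hLC).finrank_eq, hLd] at h1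
      omega
    refine hnn (C.map (vPerp p V B v).subtype) ?_ ?_
    · rintro _ ⟨x, hx, rfl⟩ _ ⟨y, hy, rfl⟩
      exact hW _ hx _ hy
    · rw [Submodule.finrank_map_subtype_eq, hCd]
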